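/- arXiv:2012.13770 — 2 statements merged into one kernel-verified Lean document; each statement's English description precedes it below -/
import Mathlib

section
/- Let M ⊂ ℝⁿ be compact and connected, with intrinsic distance d_M, and assume every pair of points x, y ∈ M is joined by a Lipschitz curve in M of length equal to d_M(x,y). Let ε > 0, c > 0, C > 0, and let f ∈ C(M;ℝⁿ) satisfy c·d_M(x,y) ≤ |f(x) − f(y)| ≤ C·d_M(x,y) whenever d_M(x,y) < ε. Assume moreover that f is injective and that its inverse f⁻¹ : Σ → M is continuous from Σ := f(M) (with the Euclidean topology) to (M, d_M). Then c·d_M(x,y) ≤ d_Σ(f(x), f(y)) for all x, y ∈ M. -/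
open Set Metric Filter Topology ENNReal

noncomputable section

abbrev E (n : ℕ) := EuclideanSpace ℝ (Fin n)

/-- Length of a curve: its total variation on `[0,1]`. -/
def curveLen {n : ℕ} (θ : ℝ → E n) : ℝ≥0∞ := eVariationOn θ (Set.Icc (0 : ℝ) 1)

/-- Intrinsic (geodesic) distance of a set `A ⊆ ℝⁿ`, with values in `[0,∞]`:
the infimum of lengths of continuous (rectifiable) curves in `A` joining the two points. -/
def intrinsicDistE {n : ℕ} (A : Set (E n)) (u v : E n) : ℝ≥0∞ :=
  ⨅ (θ : ℝ → E n) (_ : ContinuousOn θ (Set.Icc 0 1)) (_ : Set.MapsTo θ (Set.Icc 0 1) A)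
    (_ : θ 0 = u) (_ : θ 1 = v), curveLen θ

/-- Real-valued intrinsic (geodesic) distance. -/
def intrinsicDist {n : ℕ} (A : Set (E n)) (u v : E n) : ℝ :=
  (intrinsicDistE A u v).toReal

/-- Federer's reach of `M`: the supremum of `ε > 0` such that every point of the open
`ε`-neighborhood of `M` has a unique nearest point on `M`. -/
def reach {n : ℕ} (M : Set (E n)) : ℝ :=
  sSup {ε : ℝ | 0 < ε ∧ ∀ x ∈ Metric.thickening ε M,
    ∃! y, y ∈ M ∧ dist x y = Metric.infDist x M}

/-- `M` is a smooth embedded submanifold of `ℝⁿ` (local smooth injective immersive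
parametrizations of a fixed dimension). -/
def IsSmoothSubmanifold {n : ℕ} (M : Set (E n)) : Prop :=
  ∃ d : ℕ, ∀ x ∈ M,
    ∃ (U : Set (E n)) (V : Set (EuclideanSpace ℝ (Fin d)))
      (ψ : EuclideanSpace ℝ (Fin d) → E n),
      IsOpen U ∧ x ∈ U ∧ IsOpen V ∧ ContDiffOn ℝ (⊤ : ℕ∞) ψ V ∧ Set.InjOn ψ V ∧
      ψ '' V = M ∩ U ∧ ∀ v ∈ V, Function.Injective (fderiv ℝ ψ v)

/-- A relation on `[0,1]` which is transitive along increasing triples and holds locally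
around every point relates `0` to `1`. -/
theorem rel_zero_one_of_locally {P : ℝ → ℝ → Prop}
    (htrans : ∀ s t u, 0 ≤ s → s ≤ t → t ≤ u → u ≤ 1 → P s t → P t u → P s u)
    (hlocal : ∀ t ∈ Icc (0 : ℝ) 1, ∃ r > 0, ∀ s ∈ Icc (0 : ℝ) 1, ∀ s' ∈ Icc (0 : ℝ) 1,
      dist s t < r → dist s' t < r → s ≤ s' → P s s') : P 0 1 := by
  choose! r hr hP using hlocal
  obtain ⟨t, ht0, htm, ⟨m, hm⟩, hsub⟩ := exists_monotone_Icc_subset_open_cover_Icc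
    (zero_le_one' ℝ) (c := fun i : Icc (0 : ℝ) 1 => ball i (r i)) (fun _ => isOpen_ball)
    (fun i _ => mem_iUnion.2 ⟨i, mem_ball_self (hr i i.2)⟩)
  have key : ∀ k, P 0 (t k) := by
    intro k
    induction k with
    | zero =>
      rw [ht0]
      have h0 : (0 : ℝ) ∈ Icc (0 : ℝ) 1 := by simp
      exact hP 0 h0 0 h0 0 h0 (by simpa using hr 0 h0) (by simpa using hr 0 h0) le_rfl
    | succ k ih =>
      obtain ⟨i, hi⟩ := hsub k
      have hk : t k ≤ t (k + 1) := htm k.le_succ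
      exact htrans 0 (t k) (t (k + 1)) le_rfl (t k).2.1 hk (t (k + 1)).2.2 ih
        (hP i i.2 _ (t k).2 _ (t (k + 1)).2 (hi (left_mem_Icc.2 hk)) (hi (right_mem_Icc.2 hk)) hk)
  simpa [hm m le_rfl] using key m

theorem eVariationOn_Icc_add_Icc {n : ℕ} (θ : ℝ → E n) {a b d : ℝ} (hab : a ≤ b) (hbd : b ≤ d) :
    eVariationOn θ (Icc a b) + eVariationOn θ (Icc b d) = eVariationOn θ (Icc a d) := by
  simpa using eVariationOn.Icc_add_Icc θ (s := univ) hab hbd (mem_univ b)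

theorem intrinsicDistE_le_curveLen {n : ℕ} {A : Set (E n)} {θ : ℝ → E n}
    (hθ : ContinuousOn θ (Icc 0 1)) (hA : MapsTo θ (Icc 0 1) A) :
    intrinsicDistE A (θ 0) (θ 1) ≤ curveLen θ :=
  iInf_le_of_le θ <| iInf_le_of_le hθ <| iInf_le_of_le hA <| iInf_le_of_le rfl <|
    iInf_le_of_le rfl le_rfl

theorem intrinsicDistE_le_eVariationOn {n : ℕ} {A : Set (E n)} {θ : ℝ → E n} {a b : ℝ}
    (hab : a ≤ b) (hθ : ContinuousOn θ (Icc a b)) (hA : MapsTo θ (Icc a b) A) :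
    intrinsicDistE A (θ a) (θ b) ≤ eVariationOn θ (Icc a b) := by
  set φ : ℝ → ℝ := fun t => a + t * (b - a) with hφ
  have hmaps : MapsTo φ (Icc 0 1) (Icc a b) := by
    rintro t ⟨h0, h1⟩
    constructor <;> simp only [hφ] <;> nlinarith
  have hmono : MonotoneOn φ (Icc 0 1) := by
    intro s _ t _ hst
    simp only [hφ]
    nlinarith
  have h := intrinsicDistE_le_curveLen (θ := θ ∘ φ)
    (hθ.comp (by fun_prop) hmaps) (hA.comp hmaps)
  simp only [Function.comp_apply, hφ, zero_mul, add_zero, one_mul, add_sub_cancel] at h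
  exact h.trans (eVariationOn.comp_le_of_monotoneOn θ φ hmono hmaps)

theorem intrinsicDistE_comm_le {n : ℕ} (A : Set (E n)) (u v : E n) :
    intrinsicDistE A v u ≤ intrinsicDistE A u v := by
  refine le_iInf fun θ => le_iInf fun hθ => le_iInf fun hA => le_iInf fun h0 => le_iInf fun h1 => ?_
  have hmaps : MapsTo (fun t : ℝ => 1 - t) (Icc 0 1) (Icc 0 1) := by
    rintro t ⟨h0, h1⟩
    constructor <;> linarith
  have h := intrinsicDistE_le_curveLen (θ := θ ∘ fun t : ℝ => 1 - t)
    (hθ.comp (by fun_prop) hmaps) (hA.comp hmaps)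
  simp only [Function.comp_apply, sub_zero, sub_self, h0, h1] at h
  refine h.trans (eVariationOn.comp_le_of_antitoneOn θ _ ?_ hmaps)
  intro s _ t _ hst
  exact sub_le_sub_left hst 1

theorem intrinsicDistE_comm {n : ℕ} (A : Set (E n)) (u v : E n) :
    intrinsicDistE A u v = intrinsicDistE A v u :=
  le_antisymm (intrinsicDistE_comm_le A v u) (intrinsicDistE_comm_le A u v)

theorem intrinsicDistE_triangle {n : ℕ} (A : Set (E n)) (u v w : E n) :
    intrinsicDistE A u w ≤ intrinsicDistE A u v + intrinsicDistE A v w := by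
  have key : ∀ θ : ℝ → E n, ContinuousOn θ (Icc 0 1) → MapsTo θ (Icc 0 1) A → θ 0 = u → θ 1 = v →
      ∀ η : ℝ → E n, ContinuousOn η (Icc 0 1) → MapsTo η (Icc 0 1) A → η 0 = v → η 1 = w →
      intrinsicDistE A u w ≤ curveLen θ + curveLen η := by
    intro θ hθ hθA hθ0 hθ1 η hη hηA hη0 hη1
    set ζ : ℝ → E n := fun t => if t ≤ 1 then θ t else η (t - 1) with hζ
    have hleft : EqOn ζ θ (Icc 0 1) := fun t ht => if_pos ht.2
    have hright : EqOn ζ (η ∘ fun t => t - 1) (Icc 1 2) := by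
      intro t ht
      rcases ht.1.eq_or_lt with rfl | hlt
      · simp [hζ, hθ1, hη0]
      · simp [hζ, not_le.2 hlt]
    have hmaps : MapsTo (fun t : ℝ => t - 1) (Icc 1 2) (Icc 0 1) := by
      rintro t ⟨h0, h1⟩
      constructor <;> linarith
    have hunion : Icc (0 : ℝ) 2 = Icc 0 1 ∪ Icc 1 2 :=
      (Icc_union_Icc_eq_Icc zero_le_one one_le_two).symm
    have hcont : ContinuousOn ζ (Icc 0 2) := by
      rw [hunion]
      exact (hθ.congr hleft).union_of_isClosed
        ((hη.comp (by fun_prop) hmaps).congr hright) isClosed_Icc isClosed_Icc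
    have hA : MapsTo ζ (Icc 0 2) A := by
      rw [hunion]
      exact (hθA.congr hleft.symm).union ((hηA.comp hmaps).congr hright.symm)
    have h := intrinsicDistE_le_eVariationOn zero_le_two hcont hA
    rw [← eVariationOn_Icc_add_Icc ζ zero_le_one one_le_two, eVariationOn.congr hleft,
      eVariationOn.congr hright, hleft (by simp), hright (by simp), hθ0] at h
    have h2 : (η ∘ fun t => t - 1) 2 = w := by
      rw [← hη1]
      norm_num
    rw [h2] at h
    refine h.trans (add_le_add le_rfl (eVariationOn.comp_le_of_monotoneOn η _ ?_ hmaps))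
    intro s _ t _ hst
    exact sub_le_sub_right hst 1
  conv_rhs => unfold intrinsicDistE
  simp only [ENNReal.iInf_add, ENNReal.add_iInf, le_iInf_iff]
  intros
  apply key <;> assumption

theorem ofReal_intrinsicDist {n : ℕ} {A : Set (E n)} {u v : E n} (h : intrinsicDistE A u v ≠ ⊤) :
    ENNReal.ofReal (intrinsicDist A u v) = intrinsicDistE A u v :=
  ENNReal.ofReal_toReal h

theorem intrinsicDist_le_of_lipschitzOnWith {n : ℕ} {A : Set (E n)} {θ : ℝ → E n} {K : NNReal}
    {a b : ℝ} (hab : a ≤ b) (hθ : LipschitzOnWith K θ (Icc a b)) (hA : MapsTo θ (Icc a b) A) :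
    intrinsicDist A (θ a) (θ b) ≤ K * (b - a) := by
  have h := (intrinsicDistE_le_eVariationOn hab hθ.continuousOn hA).trans
    (hθ.comp_eVariationOn_le (g := id) (mapsTo_id _))
  rw [eVariationOn_id_Icc, ← ENNReal.ofReal_coe_nnreal, ← ENNReal.ofReal_mul K.coe_nonneg] at h
  exact ENNReal.toReal_le_of_le_ofReal (mul_nonneg K.coe_nonneg (sub_nonneg.2 hab)) h

/-- A map which is Lipschitz at small scales for the intrinsic distance sends Lipschitz curves
to rectifiable curves. -/
theorem curveLen_comp_ne_top {n : ℕ} {M : Set (E n)} {ε C : ℝ} (hε : 0 < ε) (hC : 0 < C)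
    {f : E n → E n}
    (hloc : ∀ x ∈ M, ∀ y ∈ M, intrinsicDist M x y < ε → ‖f x - f y‖ ≤ C * intrinsicDist M x y)
    {θ : ℝ → E n} {K : NNReal} (hθ : LipschitzOnWith K θ (Icc 0 1)) (hM : MapsTo θ (Icc 0 1) M) :
    curveLen (f ∘ θ) ≠ ⊤ := by
  refine rel_zero_one_of_locally (P := fun s t => eVariationOn (f ∘ θ) (Icc s t) ≠ ⊤) ?_ ?_
  · intro s t u _ hst htu _ h₁ h₂
    rw [← eVariationOn_Icc_add_Icc _ hst htu]
    exact ENNReal.add_ne_top.2 ⟨h₁, h₂⟩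
  · intro t _
    have hK : (0 : ℝ) < K + 1 := by positivity
    refine ⟨ε / (2 * (K + 1)), by positivity, fun s hs s' hs' hst hst' hss' => ?_⟩
    have hsmall : K * (s' - s) < ε := by
      have h1 : s' - s < ε / (K + 1) := by
        have h2 : ε / (K + 1) = ε / (2 * (K + 1)) + ε / (2 * (K + 1)) := by field_simp; ring
        rw [Real.dist_eq, abs_lt] at hst hst'
        linarith [hst.1, hst'.2]
      rw [lt_div_iff₀ hK] at h1
      nlinarith
    have hle : ∀ a ∈ Icc s s', ∀ b ∈ Icc s s', a ≤ b →
        dist ((f ∘ θ) a) ((f ∘ θ) b) ≤ (C.toNNReal * K : NNReal) * dist a b := by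
      intro a ha b hb hab
      have hsub : Icc a b ⊆ Icc 0 1 := Icc_subset_Icc (hs.1.trans ha.1) (hb.2.trans hs'.2)
      have hd := intrinsicDist_le_of_lipschitzOnWith hab (hθ.mono hsub) (hM.mono_left hsub)
      have hba : K * (b - a) ≤ K * (s' - s) :=
        mul_le_mul_of_nonneg_left (by linarith [ha.1, hb.2]) K.coe_nonneg
      have hf := hloc (θ a) (hM (hsub (left_mem_Icc.2 hab))) (θ b)
        (hM (hsub (right_mem_Icc.2 hab))) (by linarith)
      rw [dist_eq_norm, dist_comm, Real.dist_eq, abs_of_nonneg (sub_nonneg.2 hab), NNReal.coe_mul,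
        Real.coe_toNNReal _ hC.le, mul_assoc]
      exact hf.trans (mul_le_mul_of_nonneg_left hd hC.le)
    have hlip : LipschitzOnWith (C.toNNReal * K) (f ∘ θ) (Icc s s') := by
      refine LipschitzOnWith.of_dist_le_mul fun a ha b hb => ?_
      rcases le_total a b with hab | hba
      · exact hle a ha b hb hab
      · rw [dist_comm, dist_comm a b]
        exact hle b hb a ha hba
    have hvar := hlip.locallyBoundedVariationOn s s' (left_mem_Icc.2 hss') (right_mem_Icc.2 hss')
    rwa [inter_self] at hvar

/-- If `M ⊆ ℝⁿ` is compact and connected, every pair of points of `M` is joined in `M` by a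
Lipschitz curve of length equal to their intrinsic distance, and `f ∈ C(M;ℝⁿ)` satisfies
`c·d_M(x,y) ≤ |f(x) − f(y)| ≤ C·d_M(x,y)` whenever `d_M(x,y) < ε`, and moreover `f` is
injective on `M` with inverse `f⁻¹ : Σ → M` continuous from `Σ := f(M)` (Euclidean topology)
to `(M, d_M)`, then `c·d_M(x,y) ≤ d_Σ(f(x), f(y))` for all `x, y ∈ M`. -/
theorem intrinsic_dist_image_lower {n : ℕ} (M : Set (E n))
    (hcomp : IsCompact M) (hconn : IsConnected M)
    (hgeo : ∀ x ∈ M, ∀ y ∈ M, ∃ θ : ℝ → E n,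
      (∃ K : NNReal, LipschitzOnWith K θ (Set.Icc 0 1)) ∧
      Set.MapsTo θ (Set.Icc 0 1) M ∧ θ 0 = x ∧ θ 1 = y ∧
      curveLen θ = ENNReal.ofReal (intrinsicDist M x y))
    (ε c C : ℝ) (hε : 0 < ε) (hc : 0 < c) (hC : 0 < C)
    (f : E n → E n) (hf : ContinuousOn f M)
    (hloc : ∀ x ∈ M, ∀ y ∈ M, intrinsicDist M x y < ε →
      c * intrinsicDist M x y ≤ ‖f x - f y‖ ∧ ‖f x - f y‖ ≤ C * intrinsicDist M x y)
    (hinj : Set.InjOn f M)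
    (hinvcont : ∀ u ∈ M, ∀ δ : ℝ, 0 < δ → ∃ ρ : ℝ, 0 < ρ ∧
      ∀ v ∈ M, ‖f v - f u‖ < ρ → intrinsicDist M u v < δ) :
    ∀ x ∈ M, ∀ y ∈ M, c * intrinsicDist M x y ≤ intrinsicDist (f '' M) (f x) (f y) := by
  have hfin : ∀ x ∈ M, ∀ y ∈ M, intrinsicDistE M x y ≠ ⊤ := by
    intro x hx y hy
    obtain ⟨θ, ⟨K, hK⟩, hM, rfl, rfl, hlen⟩ := hgeo x hx y hy
    exact ne_top_of_le_ne_top (hlen ▸ ENNReal.ofReal_ne_top)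
      (intrinsicDistE_le_curveLen hK.continuousOn hM)
  have htri : ∀ x ∈ M, ∀ y ∈ M, ∀ z ∈ M,
      intrinsicDist M x z ≤ intrinsicDist M y x + intrinsicDist M y z := by
    intro x hx y hy z hz
    unfold intrinsicDist
    rw [← ENNReal.toReal_add (hfin y hy x hx) (hfin y hy z hz), intrinsicDistE_comm M y x]
    exact ENNReal.toReal_mono
      (ENNReal.add_ne_top.2 ⟨hfin x hx y hy, hfin y hy z hz⟩) (intrinsicDistE_triangle M x y z)
  intro x hx y hy
  have hfin_image : intrinsicDistE (f '' M) (f x) (f y) ≠ ⊤ := by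
    obtain ⟨θ, ⟨K, hK⟩, hM, rfl, rfl, -⟩ := hgeo x hx y hy
    exact ne_top_of_le_ne_top
      (curveLen_comp_ne_top hε hC (fun a ha b hb hab => (hloc a ha b hb hab).2) hK hM)
      (intrinsicDistE_le_curveLen (θ := f ∘ θ) (hf.comp hK.continuousOn hM)
        ((mapsTo_image f M).comp hM))
  suffices h : ENNReal.ofReal c * intrinsicDistE M x y ≤ intrinsicDistE (f '' M) (f x) (f y) by
    have h' := ENNReal.toReal_mono hfin_image h
    rwa [ENNReal.toReal_mul, ENNReal.toReal_ofReal hc.le] at h'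
  refine le_iInf fun σ => le_iInf fun hσ => le_iInf fun hA => le_iInf fun h0 => le_iInf fun h1 => ?_
  obtain ⟨γ, hγM, hγ⟩ : ∃ γ : ℝ → E n,
      (∀ {t}, t ∈ Icc (0 : ℝ) 1 → γ t ∈ M) ∧ ∀ {t}, t ∈ Icc (0 : ℝ) 1 → f (γ t) = σ t := by
    have hpre : ∀ t ∈ Icc (0 : ℝ) 1, ∃ z ∈ M, f z = σ t := fun t ht => hA ht
    choose! γ hγM hγ using hpre
    exact ⟨γ, fun ht => hγM _ ht, fun ht => hγ _ ht⟩
  have hγ0 : γ 0 = x := hinj (hγM (by simp)) hx ((hγ (by simp)).trans h0)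
  have hγ1 : γ 1 = y := hinj (hγM (by simp)) hy ((hγ (by simp)).trans h1)
  rw [← hγ0, ← hγ1]
  refine rel_zero_one_of_locally (P := fun s t =>
    ENNReal.ofReal c * intrinsicDistE M (γ s) (γ t) ≤ eVariationOn σ (Icc s t)) ?_ ?_
  · intro s t u _ hst htu _ h₁ h₂
    rw [← eVariationOn_Icc_add_Icc σ hst htu]
    refine le_trans ?_ (add_le_add h₁ h₂)
    rw [← mul_add]
    gcongr
    exact intrinsicDistE_triangle M _ _ _
  · intro t ht
    obtain ⟨ρ, hρ, hρd⟩ := hinvcont (γ t) (hγM ht) (ε / 2) (half_pos hε)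
    obtain ⟨r, hr, hrd⟩ := Metric.continuousOn_iff.1 hσ t ht ρ hρ
    have hnear : ∀ s ∈ Icc (0 : ℝ) 1, dist s t < r → intrinsicDist M (γ t) (γ s) < ε / 2 := by
      intro s hs hst
      refine hρd (γ s) (hγM hs) ?_
      rw [hγ hs, hγ ht, ← dist_eq_norm]
      exact hrd s hs hst
    refine ⟨r, hr, fun s hs s' hs' hst hst' hss' => ?_⟩
    have hlt : intrinsicDist M (γ s) (γ s') < ε := by
      linarith [htri _ (hγM hs) _ (hγM ht) _ (hγM hs'), hnear s hs hst, hnear s' hs' hst']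
    have hle := (hloc _ (hγM hs) _ (hγM hs') hlt).1
    rw [hγ hs, hγ hs', ← dist_eq_norm] at hle
    rw [← ofReal_intrinsicDist (hfin _ (hγM hs) _ (hγM hs')), ← ENNReal.ofReal_mul hc.le]
    refine (ENNReal.ofReal_le_ofReal hle).trans ?_
    rw [← edist_dist]
    exact eVariationOn.edist_le σ (left_mem_Icc.2 hss') (right_mem_Icc.2 hss')
end
end

section
/- Let n ∈ ℕ, ε > 0, a < b, and let γ : [a,b] → ℝⁿ be a function such that |γ(t) − γ(s)| = |t − s| for all t, s ∈ [a,b] with |t − s| < ε. Then |γ(t) − γ(s)| = |t − s| for all t, s ∈ [a,b]; in particular γ is injective and its image is a line segment of length b − a. -/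
/-- In a strictly convex space, a map preserving distances smaller than `L` on an interval
preserves distances smaller than `3 / 2 * L`. -/
theorem norm_sub_eq_of_lt_three_halves {E : Type*} [NormedAddCommGroup E] [NormedSpace ℝ E]
    [StrictConvexSpace ℝ E] {a b L : ℝ} {γ : ℝ → E}
    (h : ∀ s t, a ≤ s → s ≤ t → t ≤ b → t - s < L → ‖γ t - γ s‖ = t - s)
    {s t : ℝ} (has : a ≤ s) (hst : s ≤ t) (htb : t ≤ b) (hL : t - s < 3 / 2 * L) :
    ‖γ t - γ s‖ = t - s := by
  obtain ⟨d, rfl⟩ : ∃ d, t = s + 3 * d := ⟨(t - s) / 3, by ring⟩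
  have h₁ := h s (s + d) (by linarith) (by linarith) (by linarith) (by linarith)
  have h₂ := h (s + d) (s + 2 * d) (by linarith) (by linarith) (by linarith) (by linarith)
  have h₃ := h (s + 2 * d) (s + 3 * d) (by linarith) (by linarith) (by linarith) (by linarith)
  have h₁₂ := h s (s + 2 * d) (by linarith) (by linarith) (by linarith) (by linarith)
  have h₂₃ := h (s + d) (s + 3 * d) (by linarith) (by linarith) (by linarith) (by linarith)
  have e₁₂ : γ (s + 2 * d) - γ (s + d) = γ (s + d) - γ s := by
    refine eq_of_norm_eq_of_norm_add_eq (by linarith) ?_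
    rw [sub_add_sub_cancel]
    linarith
  have e₂₃ : γ (s + 3 * d) - γ (s + 2 * d) = γ (s + 2 * d) - γ (s + d) := by
    refine eq_of_norm_eq_of_norm_add_eq (by linarith) ?_
    rw [sub_add_sub_cancel]
    linarith
  have e : γ (s + 3 * d) - γ s = (3 : ℝ) • (γ (s + d) - γ s) := by
    calc γ (s + 3 * d) - γ s
        = (γ (s + 3 * d) - γ (s + 2 * d)) + (γ (s + 2 * d) - γ (s + d))
          + (γ (s + d) - γ s) := by abel
      _ = (3 : ℝ) • (γ (s + d) - γ s) := by rw [e₂₃, e₁₂]; module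
  rw [e, norm_smul, h₁, Real.norm_of_nonneg (by norm_num)]
  ring

/-- In a strictly convex space, a local isometry of an interval, at a uniform scale, is an
isometry. -/
theorem norm_sub_eq_of_norm_sub_eq_of_lt {E : Type*} [NormedAddCommGroup E] [NormedSpace ℝ E]
    [StrictConvexSpace ℝ E] {a b ε : ℝ} (hε : 0 < ε) {γ : ℝ → E}
    (h : ∀ s t, a ≤ s → s ≤ t → t ≤ b → t - s < ε → ‖γ t - γ s‖ = t - s)
    {s t : ℝ} (has : a ≤ s) (hst : s ≤ t) (htb : t ≤ b) : ‖γ t - γ s‖ = t - s := by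
  have key (k : ℕ) : ∀ s t, a ≤ s → s ≤ t → t ≤ b → t - s < (3 / 2 : ℝ) ^ k * ε →
      ‖γ t - γ s‖ = t - s := by
    induction k with
    | zero => simpa using h
    | succ k ih =>
      intro s t has hst htb hL
      exact norm_sub_eq_of_lt_three_halves ih has hst htb (by rw [pow_succ] at hL; linarith)
  obtain ⟨k, hk⟩ := pow_unbounded_of_one_lt ((t - s) / ε) (by norm_num : (1 : ℝ) < 3 / 2)
  exact key k s t has hst htb ((div_lt_iff₀ hε).mp hk)

/-- In a strictly convex space, the image of an interval under an isometry is the segment joining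
the images of its endpoints. -/
theorem image_Icc_eq_segment_of_norm_sub_eq {E : Type*} [NormedAddCommGroup E] [NormedSpace ℝ E]
    [StrictConvexSpace ℝ E] {a b : ℝ} (hab : a < b) {γ : ℝ → E}
    (h : ∀ s t, a ≤ s → s ≤ t → t ≤ b → ‖γ t - γ s‖ = t - s) :
    γ '' Set.Icc a b = segment ℝ (γ a) (γ b) := by
  have hγ : ∀ r ∈ Set.Icc (0 : ℝ) 1,
      γ (AffineMap.lineMap a b r) = AffineMap.lineMap (γ a) (γ b) r := by
    rintro r ⟨hr₀, hr₁⟩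
    have hr : AffineMap.lineMap a b r = a + r * (b - a) := by
      simp [AffineMap.lineMap_apply, add_comm]
    have ha : a ≤ a + r * (b - a) := by nlinarith
    have hb : a + r * (b - a) ≤ b := by nlinarith
    rw [hr]
    apply eq_lineMap_of_dist_eq_mul_of_dist_eq_mul
    · rw [dist_comm, dist_comm (γ a), dist_eq_norm, dist_eq_norm, h _ _ le_rfl ha hb,
        h _ _ le_rfl hab.le le_rfl]
      ring
    · rw [dist_comm, dist_comm (γ a), dist_eq_norm, dist_eq_norm, h _ _ ha hb le_rfl,
        h _ _ le_rfl hab.le le_rfl]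
      ring
  rw [← segment_eq_Icc hab.le, segment_eq_image_lineMap, segment_eq_image_lineMap,
    Set.image_image]
  exact Set.image_congr hγ

/-- If `γ : [a,b] → ℝⁿ` satisfies `|γ(t) − γ(s)| = |t − s|` whenever `|t − s| < ε`, then
`|γ(t) − γ(s)| = |t − s|` for all `t, s ∈ [a,b]`; in particular `γ` is injective on `[a,b]`
and its image is a line segment of length `b − a`. -/
theorem local_isometry_of_interval_propagates {n : ℕ} (ε a b : ℝ) (hε : 0 < ε) (hab : a < b)
    (γ : ℝ → EuclideanSpace ℝ (Fin n))
    (h : ∀ t ∈ Set.Icc a b, ∀ s ∈ Set.Icc a b, |t - s| < ε → ‖γ t - γ s‖ = |t - s|) :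
    (∀ t ∈ Set.Icc a b, ∀ s ∈ Set.Icc a b, ‖γ t - γ s‖ = |t - s|) ∧
    Set.InjOn γ (Set.Icc a b) ∧
    ∃ p q : EuclideanSpace ℝ (Fin n),
      γ '' Set.Icc a b = segment ℝ p q ∧ ‖q - p‖ = b - a := by
  have hle : ∀ s t, a ≤ s → s ≤ t → t ≤ b → ‖γ t - γ s‖ = t - s := by
    refine fun s t has hst htb => norm_sub_eq_of_norm_sub_eq_of_lt hε ?_ has hst htb
    intro s t has hst htb hlt
    have habs : |t - s| = t - s := abs_of_nonneg (sub_nonneg.mpr hst)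
    rw [h t ⟨has.trans hst, htb⟩ s ⟨has, hst.trans htb⟩ (habs.trans_lt hlt), habs]
  have hiso : ∀ t ∈ Set.Icc a b, ∀ s ∈ Set.Icc a b, ‖γ t - γ s‖ = |t - s| := by
    intro t ht s hs
    rcases le_total s t with hst | hts
    · rw [hle s t hs.1 hst ht.2, abs_of_nonneg (sub_nonneg.mpr hst)]
    · rw [norm_sub_rev, abs_sub_comm, hle t s ht.1 hts hs.2, abs_of_nonneg (sub_nonneg.mpr hts)]
  refine ⟨hiso, fun t ht s hs hts => ?_, γ a, γ b,
    image_Icc_eq_segment_of_norm_sub_eq hab hle, hle a b le_rfl hab.le le_rfl⟩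
  have hzero := hiso t ht s hs
  rw [hts, sub_self, norm_zero] at hzero
  exact sub_eq_zero.mp (abs_eq_zero.mp hzero.symm)
end
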